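/- Let (a,b,c,d) ∈ P with ab < cdq (both products are positive reals, so this says √(ab/(cdq)) < 1). Then the doubly infinite sums Σ_{k∈ℤ} z₊q^k·w(z₊q^k) and Σ_{k∈ℤ} z₋q^k·w(z₋q^k) converge absolutely, and Σ_{k∈ℤ} z₊q^k·w(z₊q^k) − Σ_{k∈ℤ} z₋q^k·w(z₋q^k) = z₊·(q, a/c, a/d, b/c, b/d;q)_∞·θ(z₋/z₊, cdz₋z₊) / ((ab/(cdq);q)_∞·θ(cz₋, dz₋, cz₊, dz₊)). -/

import Mathlib

open Complex Filter

noncomputable section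

namespace VVBQJ

/-- The infinite q-shifted factorial `(x;q)_∞`. -/
def poch (q x : ℂ) : ℂ := ∏' j : ℕ, (1 - x * q ^ j)

/-- The q-shifted factorial `(x;q)_n`, `n ∈ ℕ`. -/
def pochN (q x : ℂ) (n : ℕ) : ℂ := ∏ j ∈ Finset.range n, (1 - x * q ^ j)

/-- The normalized Jacobi theta function `θ(x) = (x;q)_∞ (q/x;q)_∞`. -/
def theta (q x : ℂ) : ℂ := poch q x * poch q (q / x)

/-- The condition on the pairs `(a,b)` and `(c,d)` in the parameter set `P`. -/
def pairCond (q zm zp : ℝ) (α β : ℂ) : Prop :=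
  α = (starRingEnd ℂ) β ∨
    (∃ (A B : ℝ) (k₀ : ℤ), α = (A : ℂ) ∧ β = (B : ℂ) ∧
      zp * q ^ k₀ < 1 / B ∧ 1 / B < 1 / A ∧ 1 / A < zp * q ^ (k₀ - 1)) ∨
    (∃ (A B : ℝ) (k₀ : ℤ), α = (A : ℂ) ∧ β = (B : ℂ) ∧
      zm * q ^ (k₀ - 1) < 1 / A ∧ 1 / A < 1 / B ∧ 1 / B < zm * q ^ k₀)

/-- The parameter domain `P`. -/
def memP (q zm zp : ℝ) (a b c d : ℂ) : Prop :=
  a ≠ 0 ∧ b ≠ 0 ∧ c ≠ 0 ∧ d ≠ 0 ∧ a ≠ b ∧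
    (∀ x ∈ ({a, b, c, d} : Set ℂ), ∀ k : ℤ,
      x ≠ ((zp : ℂ))⁻¹ * (q : ℂ) ^ k ∧ x ≠ ((zm : ℂ))⁻¹ * (q : ℂ) ^ k) ∧
    pairCond q zm zp a b ∧ pairCond q zm zp c d

/-- The generic parameter domain `P_gen`. -/
def memPgen (q zm zp : ℝ) (a b c d : ℂ) : Prop :=
  memP q zm zp a b c d ∧ c ≠ d ∧
    ∀ k : ℤ, c / a ≠ (q : ℂ) ^ k ∧ c / b ≠ (q : ℂ) ^ k ∧ d / a ≠ (q : ℂ) ^ k ∧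
      d / b ≠ (q : ℂ) ^ k ∧ c * d / (a * b) ≠ (q : ℂ) ^ k

/-- `s = √(cdq/(ab))`, with the principal branch of the square root. -/
def sP (q : ℝ) (a b c d : ℂ) : ℂ := (c * d * (q : ℂ) / (a * b)) ^ ((1 : ℂ) / 2)

def Acoef (q : ℝ) (a b c d : ℂ) (x : ℝ) : ℂ :=
  (sP q a b c d)⁻¹ * (1 - (q : ℂ) / (a * (x : ℂ))) * (1 - (q : ℂ) / (b * (x : ℂ)))

def Bcoef (q : ℝ) (a b c d : ℂ) (x : ℝ) : ℂ :=
  sP q a b c d * (1 - 1 / (c * (x : ℂ))) * (1 - 1 / (d * (x : ℂ)))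

def Ccoef (q : ℝ) (a b c d : ℂ) (x : ℝ) : ℂ :=
  sP q a b c d + (sP q a b c d)⁻¹ - Acoef q a b c d x - Bcoef q a b c d x

/-- The second order q-difference operator `L`. -/
def Lop (q : ℝ) (a b c d : ℂ) (f : ℝ → ℂ) (x : ℝ) : ℂ :=
  Acoef q a b c d x * f (x / q) + Bcoef q a b c d x * f (q * x) + Ccoef q a b c d x * f x

/-- The weight function `w`. -/
def w (q : ℝ) (a b c d : ℂ) (x : ℝ) : ℂ :=
  poch q (a * (x : ℂ)) * poch q (b * (x : ℂ)) / (poch q (c * (x : ℂ)) * poch q (d * (x : ℂ)))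

/-- The function `u(x) = (1-q)² B(x) x² w(x)`. -/
def u (q : ℝ) (a b c d : ℂ) (x : ℝ) : ℂ :=
  (1 - (q : ℂ)) ^ 2 * Bcoef q a b c d x * (x : ℂ) ^ 2 * w q a b c d x

/-- The Casorati determinant `D(f,g)`. -/
def casD (q : ℝ) (a b c d : ℂ) (f g : ℝ → ℂ) (x : ℝ) : ℂ :=
  (f x * g (q * x) - f (q * x) * g x) * u q a b c d x / ((1 - (q : ℂ)) * (x : ℂ))

/-- The truncated inner product `⟨f,g⟩_{k,l;m,n}`. -/
def trunc (q zm zp : ℝ) (a b c d : ℂ) (f g : ℝ → ℂ) (k l m n : ℤ) : ℂ :=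
  (1 - (q : ℂ)) *
    ((∑ j ∈ Finset.Icc n m, f (zp * q ^ j) * (starRingEnd ℂ) (g (zp * q ^ j)) *
        w q a b c d (zp * q ^ j) * ((zp * q ^ j : ℝ) : ℂ)) -
      ∑ j ∈ Finset.Icc k l, f (zm * q ^ j) * (starRingEnd ℂ) (g (zm * q ^ j)) *
        w q a b c d (zm * q ^ j) * ((zm * q ^ j : ℝ) : ℂ))

/-- The constant `K_z`. -/
def Kz (q : ℝ) (a b c d : ℂ) (z : ℝ) : ℂ :=
  (z : ℂ) * (1 - (q : ℂ)) * (theta q (a * z) * theta q (b * z)) /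
    (theta q (c * z) * theta q (d * z))

/-- Membership in the Hilbert space `ℒ²(ℝ_q, w(x) d_q x)`. -/
def memL2 (q zm zp : ℝ) (a b c d : ℂ) (f : ℝ → ℂ) : Prop :=
  Summable (fun k : ℤ => ‖f (zp * q ^ k)‖ ^ 2 * ‖w q a b c d (zp * q ^ k)‖ * |zp * q ^ k|) ∧
    Summable (fun k : ℤ => ‖f (zm * q ^ k)‖ ^ 2 * ‖w q a b c d (zm * q ^ k)‖ * |zm * q ^ k|)

/-- The inner product on `ℒ²`. -/
def innerL2 (q zm zp : ℝ) (a b c d : ℂ) (f g : ℝ → ℂ) : ℂ :=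
  (1 - (q : ℂ)) *
    ((∑' k : ℤ, f (zp * q ^ k) * (starRingEnd ℂ) (g (zp * q ^ k)) *
        w q a b c d (zp * q ^ k) * ((zp * q ^ k : ℝ) : ℂ)) -
      ∑' k : ℤ, f (zm * q ^ k) * (starRingEnd ℂ) (g (zm * q ^ k)) *
        w q a b c d (zm * q ^ k) * ((zm * q ^ k : ℝ) : ℂ))

/-- The squared `ℒ²`-norm. -/
def normSqL2 (q zm zp : ℝ) (a b c d : ℂ) (f : ℝ → ℂ) : ℝ :=
  (1 - q) *
    ((∑' k : ℤ, ‖f (zp * q ^ k)‖ ^ 2 * ‖w q a b c d (zp * q ^ k)‖ * (zp * q ^ k)) +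
      ∑' k : ℤ, ‖f (zm * q ^ k)‖ ^ 2 * ‖w q a b c d (zm * q ^ k)‖ * (-(zm * q ^ k)))

/-- The q-difference operator `D_q`. -/
def Dq (q : ℝ) (f : ℝ → ℂ) (x : ℝ) : ℂ := (f x - f (q * x)) / ((1 - (q : ℂ)) * (x : ℂ))

/-- The q-line `ℝ_q`. -/
def Rq (q zm zp : ℝ) : Set ℝ := {x | ∃ k : ℤ, x = zm * q ^ k ∨ x = zp * q ^ k}

/-- Membership in the domain `𝒟`. -/
def memD (q zm zp : ℝ) (a b c d : ℂ) (f : ℝ → ℂ) : Prop :=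
  memL2 q zm zp a b c d f ∧ memL2 q zm zp a b c d (Lop q a b c d f) ∧
    (∃ v : ℂ, Tendsto (fun k : ℕ => f (zm * q ^ k)) atTop (nhds v) ∧
        Tendsto (fun k : ℕ => f (zp * q ^ k)) atTop (nhds v)) ∧
    (∃ v : ℂ, Tendsto (fun k : ℕ => Dq q f (zm * q ^ k)) atTop (nhds v) ∧
        Tendsto (fun k : ℕ => Dq q f (zp * q ^ k)) atTop (nhds v))

/-- Membership in the eigenspace `V_μ` (functions on `ℝ_q`). -/
def memV (q zm zp : ℝ) (a b c d : ℂ) (μ : ℂ) (f : ℝ → ℂ) : Prop :=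
  (∀ x ∈ Rq q zm zp, Lop q a b c d f x = μ * f x) ∧
    (∃ v : ℂ, Tendsto (fun k : ℕ => f (zm * q ^ k)) atTop (nhds v) ∧
        Tendsto (fun k : ℕ => f (zp * q ^ k)) atTop (nhds v)) ∧
    (∃ v : ℂ, Tendsto (fun k : ℕ => Dq q f (zm * q ^ k)) atTop (nhds v) ∧
        Tendsto (fun k : ℕ => Dq q f (zp * q ^ k)) atTop (nhds v))

/-- The set of regular spectral values `S_reg = ℂ* \ {± q^{k/2}}`. -/
def Sreg (q : ℝ) (γ : ℂ) : Prop :=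
  γ ≠ 0 ∧ ∀ k : ℤ, γ ≠ ((q ^ ((k : ℝ) / 2) : ℝ) : ℂ) ∧ γ ≠ -((q ^ ((k : ℝ) / 2) : ℝ) : ℂ)

/-- The big q-Jacobi function `φ_γ(x)`. -/
def phi (q : ℝ) (a b c d : ℂ) (γ x : ℂ) : ℂ :=
  ∑' n : ℕ,
    pochN q (q / (a * x)) n * pochN q (sP q a b c d * γ) n * pochN q (sP q a b c d / γ) n /
      (pochN q q n * pochN q (c * q / a) n * pochN q (d * q / a) n) * (b * x) ^ n

/-- The asymptotic solution `Φ_γ(z q^{-k})`, in index form. -/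
def PhiIdx (q : ℝ) (a b c d : ℂ) (γ : ℂ) (z : ℝ) (k : ℤ) : ℂ :=
  let s : ℂ := sP q a b c d
  let x : ℂ := (z : ℂ) * (q : ℂ) ^ (-k)
  (s * γ) ^ k *
    (poch q ((q : ℂ) / (b * x)) * poch q ((q : ℂ) ^ 2 * γ / (a * s * x)) /
      (poch q ((q : ℂ) / (c * x)) * poch q ((q : ℂ) / (d * x)))) *
    ∑' n : ℕ,
      pochN q ((q : ℂ) * γ / s) n * pochN q (c * q * γ / (s * a)) n *
          pochN q (d * q * γ / (s * a)) n /
        (pochN q q n * pochN q ((q : ℂ) ^ 2 * γ / (a * s * x)) n * pochN q ((q : ℂ) * γ ^ 2) n) *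
        ((q : ℂ) / (b * x)) ^ n

/-- Casorati determinant at `x = z q^{-k}` for index-form functions. -/
def casDIdx (q : ℝ) (a b c d : ℂ) (f g : ℤ → ℂ) (z : ℝ) (k : ℤ) : ℂ :=
  (f k * g (k - 1) - f (k - 1) * g k) * u q a b c d (z * q ^ (-k)) /
    ((1 - (q : ℂ)) * ((z * q ^ (-k) : ℝ) : ℂ))

/-- The c-function `c_z(γ)`. -/
def cz (q : ℝ) (a b c d : ℂ) (z : ℝ) (γ : ℂ) : ℂ :=
  let s : ℂ := sP q a b c d
  poch q (s / γ) * poch q (c * q / (a * s * γ)) * poch q (d * q / (a * s * γ)) *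
      theta q (b * s * z * γ) /
    (poch q (c * q / a) * poch q (d * q / a) * poch q (1 / γ ^ 2) * theta q (b * z))

/-- The expansion coefficient `d_z(γ)`. -/
def dz (q : ℝ) (a b c d : ℂ) (z : ℝ) (γ : ℂ) : ℂ :=
  let s : ℂ := sP q a b c d
  (poch q (c * q / a) * poch q (d * q / a) * theta q (b * z) /
      (theta q (a / b) * theta q (c * z) * theta q (d * z))) *
    (poch q (c * q * γ / (s * b)) * poch q (d * q * γ / (s * b)) *
        theta q (a * s * z / (q * γ)) /
      (poch q (q * γ ^ 2) * poch q (s / γ)))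

/-- The Casorati determinant `v(γ) = D(Φ_γ^+, Φ_γ^-)`. -/
def vFun (q zm zp : ℝ) (a b c d : ℂ) (γ : ℂ) : ℂ :=
  let s : ℂ := sP q a b c d;
  -((zp : ℂ) * (1 - (q : ℂ)) * theta q ((zm : ℂ) / zp) /
      (theta q (c * zm) * theta q (d * zm) * theta q (c * zp) * theta q (d * zp))) *
    (poch q (c * q * γ / (a * s)) * poch q (d * q * γ / (a * s)) * poch q (c * q * γ / (b * s)) *
        poch q (d * q * γ / (b * s)) * poch q (s * γ) * poch q (q * γ / s) *
        theta q (a * b * s * zm * zp / (q * γ)) /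
      (γ * (poch q (q * γ ^ 2)) ^ 2))

/-- The function `v₁(γ)` in the continuous part of the spectral measure. -/
def v1Fun (q zm zp : ℝ) (a b c d : ℂ) (γ : ℂ) : ℂ :=
  let s : ℂ := sP q a b c d
  ((poch q (c * q / a)) ^ 2 * (poch q (d * q / a)) ^ 2 * theta q (b * zp) * theta q (b * zm) /
      ((1 - (q : ℂ)) * a * b * (zm : ℂ) ^ 2 * (zp : ℂ) ^ 2 *
        (theta q ((zm : ℂ) / zp) * theta q ((zp : ℂ) / zm) * theta q (a / b) * theta q (b / a)))) *
    (poch q (γ ^ 2) * poch q (γ⁻¹ ^ 2) /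
      (poch q (s * γ) * poch q (s / γ) * poch q (c * q * γ / (a * s)) *
        poch q (c * q / (a * s * γ)) * poch q (d * q * γ / (a * s)) *
        poch q (d * q / (a * s * γ)) *
        (theta q (s * γ) * theta q (s / γ) * theta q (a * b * s * zm * zp * γ) *
          theta q (a * b * s * zm * zp / γ)))) *
    ((zm : ℂ) * (theta q (a * zp) * theta q (c * zp) * theta q (d * zp) * theta q (b * zm) *
          theta q (a * s * zm * γ) * theta q (a * s * zm / γ)) -
      (zp : ℂ) * (theta q (a * zm) * theta q (c * zm) * theta q (d * zm) * theta q (b * zp) *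
          theta q (a * s * zp * γ) * theta q (a * s * zp / γ)))

/-- The function `v₂(γ)` in the continuous part of the spectral measure. -/
def v2Fun (q zm zp : ℝ) (a b c d : ℂ) (γ : ℂ) : ℂ :=
  let s : ℂ := sP q a b c d
  (poch q (c * q / a) * poch q (d * q / a) * poch q (c * q / b) * poch q (d * q / b) *
      (theta q (a * zp) * theta q (a * zm) * theta q (b * zp) * theta q (b * zm) *
        theta q (c * d * zm * zp)) /
      (a * b * (zm : ℂ) ^ 2 * (zp : ℂ) * (1 - (q : ℂ)) *
        (theta q ((zp : ℂ) / zm) * theta q (a / b) * theta q (b / a)))) *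
    (poch q (γ ^ 2) * poch q (γ⁻¹ ^ 2) /
      (poch q (s * γ) * poch q (s / γ) *
        (theta q (s * γ) * theta q (s / γ) * theta q (a * b * s * zm * zp * γ) *
          theta q (a * b * s * zm * zp / γ))))

/-- The function `u₁(γ)`. -/
def u1Fun (q zm zp : ℝ) (a b c d : ℂ) (γ : ℂ) : ℂ :=
  Kz q a b c d zp * cz q a b c d zp γ * cz q a b c d zp γ⁻¹ -
    Kz q a b c d zm * cz q a b c d zm γ * cz q a b c d zm γ⁻¹

/-- The function `u₂(γ)`. -/
def u2Fun (q zm zp : ℝ) (a b c d : ℂ) (γ : ℂ) : ℂ :=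
  Kz q a b c d zp * cz q a b c d zp γ * cz q b a c d zp γ⁻¹ -
    Kz q a b c d zm * cz q a b c d zm γ * cz q b a c d zm γ⁻¹

/-- The big q-Jacobi polynomial `P_k(y; α, β, δ; q)`. -/
def bigqJacobiP (q : ℝ) (α β δ : ℂ) (k : ℕ) (y : ℂ) : ℂ :=
  ∑ j ∈ Finset.range (k + 1),
    pochN q (((q : ℂ) ^ k)⁻¹) j * pochN q (α * β * (q : ℂ) ^ (k + 1)) j * pochN q y j /
      (pochN q q j * pochN q (α * q) j * pochN q (δ * q) j) * (q : ℂ) ^ j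

section Pochhammer

variable {q : ℝ}

lemma summable_norm_neg_mul_pow (h0 : 0 < q) (h1 : q < 1) (y : ℂ) :
    Summable fun j : ℕ => ‖-(y * (q : ℂ) ^ j)‖ := by
  simpa [abs_of_pos h0] using (summable_geometric_of_lt_one h0.le h1).mul_left ‖y‖

lemma multipliable_poch (h0 : 0 < q) (h1 : q < 1) (y : ℂ) :
    Multipliable fun j : ℕ => (1 - y * (q : ℂ) ^ j) := by
  simpa [sub_eq_add_neg] using
    multipliable_one_add_of_summable (summable_norm_neg_mul_pow h0 h1 y)

lemma tendsto_pochN (h0 : 0 < q) (h1 : q < 1) (y : ℂ) :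
    Tendsto (pochN q y) atTop (nhds (poch q y)) :=
  (multipliable_poch h0 h1 y).hasProd.tendsto_prod_nat

lemma poch_zero (Q : ℂ) : poch Q 0 = 1 := by simp [poch]

lemma pochN_succ' (Q y : ℂ) (n : ℕ) : pochN Q y (n + 1) = (1 - y) * pochN Q (y * Q) n := by
  simp only [pochN, Finset.prod_range_succ', pow_zero, mul_one, mul_comm (1 - y)]
  congr 1
  refine Finset.prod_congr rfl fun j _ => ?_
  ring

lemma poch_eq_mul (h0 : 0 < q) (h1 : q < 1) (y : ℂ) :
    poch q y = (1 - y) * poch q (y * q) := by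
  refine tendsto_nhds_unique ((tendsto_add_atTop_iff_nat 1).2 (tendsto_pochN h0 h1 y)) ?_
  simp only [pochN_succ']
  exact (tendsto_pochN h0 h1 _).const_mul _

lemma poch_ne_zero (h0 : 0 < q) (h1 : q < 1) {y : ℂ} (hy : ∀ j : ℕ, y * (q : ℂ) ^ j ≠ 1) :
    poch q y ≠ 0 := by
  have := tprod_one_add_ne_zero_of_summable (f := fun j : ℕ => -(y * (q : ℂ) ^ j))
    (fun j => by rw [← sub_eq_add_neg]; exact sub_ne_zero.2 (hy j).symm)
    (summable_norm_neg_mul_pow h0 h1 y)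
  simpa [poch, sub_eq_add_neg] using this

lemma poch_ne_zero_of_norm_lt_one (h0 : 0 < q) (h1 : q < 1) {y : ℂ} (hy : ‖y‖ < 1) :
    poch q y ≠ 0 := by
  refine poch_ne_zero h0 h1 fun j h => ?_
  have h2 : ‖y * (q : ℂ) ^ j‖ < 1 := by
    rw [norm_mul, norm_pow, Complex.norm_real, Real.norm_of_nonneg h0.le]
    exact mul_lt_one_of_nonneg_of_lt_one_left (norm_nonneg _) hy (pow_le_one₀ h0.le h1.le)
  rw [h, norm_one] at h2
  exact lt_irrefl _ h2

lemma norm_poch_sub_one_le (h0 : 0 < q) (h1 : q < 1) (y : ℂ) :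
    ‖poch q y - 1‖ ≤ Real.exp (‖y‖ * (1 - q)⁻¹) - 1 := by
  refine le_of_tendsto ((tendsto_pochN h0 h1 y).sub_const 1).norm (Eventually.of_forall fun n => ?_)
  have h := Finset.norm_prod_one_add_sub_one_le (Finset.range n) fun j : ℕ => -(y * (q : ℂ) ^ j)
  simp only [← sub_eq_add_neg] at h
  refine h.trans (sub_le_sub_right (Real.exp_le_exp.2 ?_) 1)
  refine ((summable_norm_neg_mul_pow h0 h1 y).sum_le_tsum _ fun _ _ => norm_nonneg _).trans ?_
  simp [abs_of_pos h0, tsum_mul_left, tsum_geometric_of_lt_one h0.le h1]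

lemma tendsto_poch_one (h0 : 0 < q) (h1 : q < 1) {ι : Type*} {l : Filter ι} {f : ι → ℂ}
    (hf : Tendsto f l (nhds 0)) : Tendsto (fun i => poch q (f i)) l (nhds 1) := by
  rw [tendsto_iff_norm_sub_tendsto_zero]
  refine squeeze_zero (fun _ => norm_nonneg _) (fun i => norm_poch_sub_one_le h0 h1 (f i)) ?_
  have h : Tendsto (fun i => Real.exp (‖f i‖ * (1 - q)⁻¹) - 1) l
      (nhds (Real.exp (‖(0 : ℂ)‖ * (1 - q)⁻¹) - 1)) :=
    ((Real.continuous_exp.tendsto _).comp (hf.norm.mul_const _)).sub_const 1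
  simpa using h

lemma norm_poch_le (h0 : 0 < q) (h1 : q < 1) {y : ℂ} {t : ℝ} (hy : ‖y‖ ≤ t) :
    ‖poch q y‖ ≤ ‖poch q (-(t : ℂ))‖ := by
  refine le_of_tendsto_of_tendsto' (tendsto_pochN h0 h1 y).norm (tendsto_pochN h0 h1 _).norm
    fun n => ?_
  simp only [pochN, norm_prod]
  refine Finset.prod_le_prod (fun _ _ => norm_nonneg _) fun j _ => ?_
  have ht : 0 ≤ t := (norm_nonneg y).trans hy
  have h2 : (1 - -(t : ℂ) * (q : ℂ) ^ j) = ((1 + t * q ^ j : ℝ) : ℂ) := by push_cast; ring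
  rw [h2, Complex.norm_real, Real.norm_of_nonneg (by positivity)]
  refine (norm_sub_le _ _).trans ?_
  rw [norm_one, norm_mul, norm_pow, Complex.norm_real, Real.norm_of_nonneg h0.le]
  gcongr

end Pochhammer

section Telescoping

lemma tsum_nat_telescope {h : ℕ → ℂ} {A : ℂ} (hs : Summable fun n => h (n + 1) - h n)
    (hA : Tendsto h atTop (nhds A)) : ∑' n, (h (n + 1) - h n) = A - h 0 := by
  refine tendsto_nhds_unique hs.hasSum.tendsto_sum_nat ?_
  simp only [Finset.sum_range_sub]
  exact hA.sub_const _

lemma tsum_int_eq_add {f : ℤ → ℂ} (hs : Summable f) :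
    ∑' k, f k = ∑' n : ℕ, f n + ∑' n : ℕ, f (-((n : ℤ) + 1)) :=
  tsum_of_nat_of_neg_add_one (hs.comp_injective Nat.cast_injective)
    (hs.comp_injective (i := fun n : ℕ => -((n : ℤ) + 1)) fun m n h => by simpa using h)

lemma tsum_int_telescope {h : ℤ → ℂ} {A B : ℂ} (hs : Summable fun k => h (k + 1) - h k)
    (hA : Tendsto h atTop (nhds A)) (hB : Tendsto h atBot (nhds B)) :
    ∑' k, (h (k + 1) - h k) = A - B := by
  let u : ℕ → ℂ := fun n => h n
  let v : ℕ → ℂ := fun n => -h (-(n : ℤ))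
  have e1 (n : ℕ) : h ((n : ℤ) + 1) - h n = u (n + 1) - u n := by simp [u]
  have e2 (n : ℕ) : h (-((n : ℤ) + 1) + 1) - h (-((n : ℤ) + 1)) = v (n + 1) - v n := by
    rw [show -((n : ℤ) + 1) + 1 = -(n : ℤ) by ring]
    simp only [v]
    push_cast
    ring
  have s1 : Summable fun n : ℕ => h ((n : ℤ) + 1) - h n :=
    hs.comp_injective Nat.cast_injective
  have s2 : Summable fun n : ℕ => h (-((n : ℤ) + 1) + 1) - h (-((n : ℤ) + 1)) :=
    hs.comp_injective (i := fun n : ℕ => -((n : ℤ) + 1)) fun m n h => by simpa using h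
  have l1 : Tendsto u atTop (nhds A) := hA.comp tendsto_natCast_atTop_atTop
  have l2 : Tendsto v atTop (nhds (-B)) :=
    (hB.comp (tendsto_neg_atTop_atBot.comp tendsto_natCast_atTop_atTop)).neg
  have t1 := (tsum_congr e1).trans (tsum_nat_telescope ((summable_congr e1).1 s1) l1)
  have t2 := (tsum_congr e2).trans (tsum_nat_telescope ((summable_congr e2).1 s2) l2)
  have key := tsum_int_eq_add hs
  rw [t1, t2] at key
  rw [key]
  simp only [u, v, Nat.cast_zero, neg_zero]
  ring

end Telescoping

section Weight

variable {q : ℝ}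

/-- The weight function extended to complex arguments. -/
def cweight (q : ℝ) (a b c d x : ℂ) : ℂ :=
  poch q (a * x) * poch q (b * x) / (poch q (c * x) * poch q (d * x))

lemma cweight_swap_num (a b c d x : ℂ) : cweight q a b c d x = cweight q b a c d x := by
  simp only [cweight, mul_comm]

lemma cweight_swap_den (a b c d x : ℂ) : cweight q a b c d x = cweight q a b d c x := by
  simp only [cweight, mul_comm (poch q (c * x))]

lemma cweight_mul_q (h0 : 0 < q) (h1 : q < 1) (a b : ℂ) {c d x : ℂ} (hc : c * x ≠ 1)
    (hd : d * x ≠ 1) :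
    (1 - a * x) * (1 - b * x) * cweight q a b c d (x * q) =
      (1 - c * x) * (1 - d * x) * cweight q a b c d x := by
  have hc' : 1 - c * x ≠ 0 := sub_ne_zero.2 hc.symm
  have hd' : 1 - d * x ≠ 0 := sub_ne_zero.2 hd.symm
  simp only [cweight, ← mul_assoc, poch_eq_mul h0 h1 (a * x), poch_eq_mul h0 h1 (b * x),
    poch_eq_mul h0 h1 (c * x), poch_eq_mul h0 h1 (d * x)]
  generalize 1 - c * x = C at hc' ⊢
  generalize 1 - d * x = D at hd' ⊢
  simp only [div_eq_mul_inv, mul_inv]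
  field_simp

lemma cweight_num_shift (h0 : 0 < q) (h1 : q < 1) (a b c d x : ℂ) :
    cweight q a b c d x = (1 - a * x) * cweight q (a * q) b c d x := by
  simp only [cweight, poch_eq_mul h0 h1 (a * x), mul_right_comm a (q : ℂ) x]
  ring

lemma cweight_den_shift (h0 : 0 < q) (h1 : q < 1) (a b d : ℂ) {c x : ℂ} (hc : c * x ≠ 1) :
    cweight q a b (c * q) d x = (1 - c * x) * cweight q a b c d x := by
  have hc' : 1 - c * x ≠ 0 := sub_ne_zero.2 hc.symm
  simp only [cweight, poch_eq_mul h0 h1 (c * x), mul_right_comm c (q : ℂ) x]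
  generalize 1 - c * x = C at hc' ⊢
  simp only [div_eq_mul_inv, mul_inv]
  field_simp

lemma tendsto_cweight_one (h0 : 0 < q) (h1 : q < 1) (a b c d : ℂ) {ι : Type*} {l : Filter ι}
    {f : ι → ℂ} (hf : Tendsto f l (nhds 0)) :
    Tendsto (fun i => cweight q a b c d (f i)) l (nhds 1) := by
  have h (e : ℂ) : Tendsto (fun i => poch q (e * f i)) l (nhds 1) :=
    tendsto_poch_one h0 h1 (by simpa using hf.const_mul e)
  have := ((h a).mul (h b)).div ((h c).mul (h d)) (by simp)
  simp only [mul_one, div_one] at this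
  exact this

lemma tendsto_cweight_num_zero (h0 : 0 < q) (h1 : q < 1) (a b c d x : ℂ) :
    Tendsto (fun n : ℕ => cweight q (a * (q : ℂ) ^ n) b c d x) atTop
      (nhds (cweight q 0 b c d x)) := by
  have hp : Tendsto (fun n : ℕ => poch q (a * (q : ℂ) ^ n * x)) atTop (nhds 1) := by
    refine tendsto_poch_one h0 h1 ?_
    have : Tendsto (fun n : ℕ => (q : ℂ) ^ n) atTop (nhds 0) :=
      tendsto_pow_atTop_nhds_zero_of_norm_lt_one (by simpa [abs_of_pos h0] using h1)
    simpa using (this.const_mul a).mul_const x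
  simp only [cweight, zero_mul, poch_zero]
  exact (hp.mul_const _).div_const _

lemma tendsto_qpow_nat (h0 : 0 < q) (h1 : q < 1) (z : ℂ) :
    Tendsto (fun n : ℕ => z * (q : ℂ) ^ n) atTop (nhds 0) := by
  simpa using (tendsto_pow_atTop_nhds_zero_of_norm_lt_one (x := (q : ℂ))
    (by simpa [abs_of_pos h0] using h1)).const_mul z

lemma tendsto_qpow_atTop (h0 : 0 < q) (h1 : q < 1) (z : ℂ) :
    Tendsto (fun k : ℤ => z * (q : ℂ) ^ k) atTop (nhds 0) := by
  rw [← Nat.map_cast_int_atTop, tendsto_map'_iff]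
  simpa [Function.comp_def] using tendsto_qpow_nat h0 h1 z

lemma tendsto_inv_qpow_atBot (h0 : 0 < q) (h1 : q < 1) (z : ℂ) :
    Tendsto (fun k : ℤ => (z * (q : ℂ) ^ k)⁻¹) atBot (nhds 0) := by
  have := (tendsto_qpow_atTop h0 h1 z⁻¹).comp tendsto_neg_atBot_atTop
  simpa [Function.comp_def, mul_comm] using this

lemma exists_norm_le_of_tendsto {f : ℕ → ℂ} {A : ℂ} (hf : Tendsto f atTop (nhds A)) :
    ∃ C, ∀ n, ‖f n‖ ≤ C := by
  obtain ⟨C, hC⟩ := hf.norm.bddAbove_range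
  exact ⟨C, fun n => hC ⟨n, rfl⟩⟩

lemma summable_nat_of_norm_le (h0 : 0 < q) (h1 : q < 1) (z : ℂ) {f : ℕ → ℂ} {C : ℝ}
    (hf : ∀ n, ‖f n‖ ≤ C) : Summable fun n : ℕ => z * (q : ℂ) ^ n * f n := by
  refine Summable.of_norm_bounded (g := fun n => ‖z‖ * q ^ n * C)
    (((summable_geometric_of_lt_one h0.le h1).mul_left _).mul_right _) fun n => ?_
  rw [norm_mul, norm_mul, norm_pow, Complex.norm_real, Real.norm_of_nonneg h0.le]
  have := hf n
  gcongr

lemma summable_nat_term (h0 : 0 < q) (h1 : q < 1) (a b c d z : ℂ) :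
    Summable fun n : ℕ => z * (q : ℂ) ^ n * cweight q a b c d (z * (q : ℂ) ^ n) := by
  obtain ⟨C, hC⟩ := exists_norm_le_of_tendsto
    (tendsto_cweight_one h0 h1 a b c d (tendsto_qpow_nat h0 h1 z))
  exact summable_nat_of_norm_le h0 h1 z hC

lemma summable_int_term (h0 : 0 < q) (h1 : q < 1) {a b c d z : ℂ}
    (h : Summable fun n : ℕ => z * (q : ℂ) ^ (-((n : ℤ) + 1)) *
      cweight q a b c d (z * (q : ℂ) ^ (-((n : ℤ) + 1)))) :
    Summable fun k : ℤ => z * (q : ℂ) ^ k * cweight q a b c d (z * (q : ℂ) ^ k) :=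
  Summable.of_nat_of_neg_add_one (by simpa using summable_nat_term h0 h1 a b c d z) h

lemma qpow_add_one (h0 : 0 < q) (z : ℂ) (k : ℤ) :
    z * (q : ℂ) ^ (k + 1) = z * (q : ℂ) ^ k * q := by
  rw [zpow_add_one₀ (by exact_mod_cast h0.ne'), mul_assoc]

lemma qpow_ne_zero (h0 : 0 < q) {z : ℂ} (hz : z ≠ 0) (k : ℤ) : z * (q : ℂ) ^ k ≠ 0 :=
  mul_ne_zero hz (zpow_ne_zero _ (by exact_mod_cast h0.ne'))

lemma summable_int_term_of_norm_lt (h0 : 0 < q) (h1 : q < 1) {a b c d z : ℂ} (hz : z ≠ 0)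
    (hc0 : c ≠ 0) (hd0 : d ≠ 0)
    (hc : ∀ k : ℤ, c * (z * (q : ℂ) ^ k) ≠ 1) (hd : ∀ k : ℤ, d * (z * (q : ℂ) ^ k) ≠ 1)
    (hlt : ‖a * b‖ < ‖c * d * q‖) :
    Summable fun k : ℤ => z * (q : ℂ) ^ k * cweight q a b c d (z * (q : ℂ) ^ k) := by
  have hq : (q : ℂ) ≠ 0 := by exact_mod_cast h0.ne'
  refine summable_int_term h0 h1 ?_
  let R : ℂ → ℂ := fun u => (u - a) * (u - b) / (q * ((u - c) * (u - d)))
  have hR : Tendsto R (nhds 0) (nhds (R 0)) := by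
    have : ContinuousAt R 0 := by
      refine ContinuousAt.div (by fun_prop) (by fun_prop) ?_
      simp [hq, hc0, hd0]
    exact this
  have hidx : Tendsto (fun n : ℕ => -((n : ℤ) + 1) - 1) atTop atBot := by
    refine tendsto_atBot.2 fun b => ?_
    filter_upwards [eventually_ge_atTop (-b).toNat] with n hn
    omega
  have hRn := (hR.comp ((tendsto_inv_qpow_atBot h0 h1 z).comp hidx)).norm
  have hlt' : ‖R 0‖ < 1 := by
    have : R 0 = a * b / (c * d * q) := by simp only [R]; ring_nf
    rw [this, norm_div, div_lt_one (by rw [norm_pos_iff]; simp [hq, hc0, hd0])]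
    exact hlt
  obtain ⟨r, hr1, hr2⟩ := exists_between hlt'
  refine summable_of_ratio_norm_eventually_le hr2 ?_
  filter_upwards [hRn.eventually_lt_const hr1] with n hn
  have hk : -((n : ℤ) + 1) = (-((n : ℤ) + 1) - 1) + 1 := by ring
  have hk' : -(((n + 1 : ℕ) : ℤ) + 1) = -((n : ℤ) + 1) - 1 := by push_cast; ring
  rw [hk', hk]
  simp only [Function.comp_apply] at hn
  generalize -((n : ℤ) + 1) - 1 = k at *
  rw [add_sub_cancel_right, qpow_add_one h0]
  have hx := qpow_ne_zero h0 hz k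
  have hck := hc k
  have hdk := hd k
  generalize z * (q : ℂ) ^ k = x at *
  have h2 := cweight_mul_q h0 h1 a b hck hdk
  have hc' : 1 - c * x ≠ 0 := sub_ne_zero.2 hck.symm
  have hd' : 1 - d * x ≠ 0 := sub_ne_zero.2 hdk.symm
  have h3 : x * cweight q a b c d x = R x⁻¹ * (x * q * cweight q a b c d (x * q)) := by
    have e (s : ℂ) : x⁻¹ - s = (1 - s * x) / x := by field_simp
    simp only [R, e]
    generalize 1 - c * x = C at hc' h2 ⊢
    generalize 1 - d * x = D at hd' h2 ⊢
    field_simp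
    linear_combination -h2
  rw [h3, norm_mul]
  gcongr

end Weight

section BilateralSum

variable {q : ℝ}

lemma poch_eq_zero {Q y : ℂ} {j : ℕ} (h : y * Q ^ j = 1) : poch Q y = 0 :=
  tprod_of_exists_eq_zero ⟨j, by rw [h, sub_self]⟩

lemma cweight_qpow_eq_zero (h0 : 0 < q) (b c d : ℂ) {z : ℂ} (hz : z ≠ 0) (m n : ℕ) :
    cweight q ((q : ℂ) ^ (m + 1) / z) b c d (z * (q : ℂ) ^ (-(((n + m : ℕ) : ℤ) + 1))) = 0 := by
  have hq : (q : ℂ) ≠ 0 := by exact_mod_cast h0.ne'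
  have : poch q ((q : ℂ) ^ (m + 1) / z * (z * (q : ℂ) ^ (-(((n + m : ℕ) : ℤ) + 1)))) = 0 := by
    refine poch_eq_zero (j := n) ?_
    rw [← mul_assoc, div_mul_cancel₀ _ hz, ← zpow_natCast, ← zpow_natCast, ← zpow_add₀ hq,
      ← zpow_add₀ hq]
    push_cast
    rw [show (m : ℤ) + 1 + -((n : ℤ) + m + 1) + n = 0 by ring, zpow_zero]
  rw [cweight, this, zero_mul, zero_div]

lemma summable_int_term_of_terminating (h0 : 0 < q) (h1 : q < 1) (b c d : ℂ) {z : ℂ}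
    (hz : z ≠ 0) (m : ℕ) :
    Summable fun k : ℤ => z * (q : ℂ) ^ k *
      cweight q ((q : ℂ) ^ (m + 1) / z) b c d (z * (q : ℂ) ^ k) := by
  refine summable_int_term h0 h1 ((summable_nat_add_iff m).1 ?_)
  simp only [cweight_qpow_eq_zero h0 b c d hz m, mul_zero]
  exact summable_zero

/-- The bilateral sum of the weight over the `q`-line through `z`. -/
def bsum (q : ℝ) (a b c d z : ℂ) : ℂ :=
  ∑' k : ℤ, z * (q : ℂ) ^ k * cweight q a b c d (z * (q : ℂ) ^ k)

lemma bsum_swap_num (a b c d z : ℂ) : bsum q a b c d z = bsum q b a c d z := by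
  simp only [bsum, cweight_swap_num a b]

lemma bsum_shift (h0 : 0 < q) (h1 : q < 1) {a b c d z : ℂ} (hz : z ≠ 0)
    (hc : ∀ k : ℤ, c * (z * (q : ℂ) ^ k) ≠ 1) (hd : ∀ k : ℤ, d * (z * (q : ℂ) ^ k) ≠ 1)
    (hs : Summable fun k : ℤ => z * (q : ℂ) ^ k * cweight q a b c d (z * (q : ℂ) ^ k))
    (hs' : Summable fun k : ℤ => z * (q : ℂ) ^ k * cweight q (a * q) b c d (z * (q : ℂ) ^ k)) :
    (a - c) * (a - d) * bsum q (a * q) b c d z - (c * d - a * b / q) * bsum q a b c d z = a := by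
  have hq : (q : ℂ) ≠ 0 := by exact_mod_cast h0.ne'
  let h : ℤ → ℂ := fun k =>
    a * ((1 - b * (z * (q : ℂ) ^ k) / q) * cweight q a b c d (z * (q : ℂ) ^ k))
  have e (k : ℤ) : h (k + 1) - h k =
      (a - c) * (a - d) * (z * (q : ℂ) ^ k * cweight q (a * q) b c d (z * (q : ℂ) ^ k)) -
        (c * d - a * b / q) * (z * (q : ℂ) ^ k * cweight q a b c d (z * (q : ℂ) ^ k)) := by
    simp only [h, qpow_add_one h0]
    have hck := hc k
    have hdk := hd k
    generalize z * (q : ℂ) ^ k = x at *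
    have s1 := cweight_num_shift h0 h1 a b c d x
    have s2 := cweight_num_shift h0 h1 a b c d (x * q)
    have s3 := cweight_mul_q h0 h1 (a * q) b hck hdk
    rw [s2, s1]
    generalize cweight q (a * q) b c d x = W at *
    generalize cweight q (a * q) b c d (x * q) = W' at *
    field_simp
    linear_combination (a * q) * s3
  have sm := (hs'.mul_left ((a - c) * (a - d))).sub (hs.mul_left (c * d - a * b / q))
  have lim1 : Tendsto h atTop (nhds a) := by
    have hx := tendsto_qpow_atTop h0 h1 z
    have := (((hx.const_mul b).div_const (q : ℂ)).const_sub 1).mul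
      (tendsto_cweight_one h0 h1 a b c d hx)
    simpa [h] using this.const_mul a
  have lim2 : Tendsto h atBot (nhds 0) := by
    have t1 : Tendsto (fun k : ℤ => z * (q : ℂ) ^ k * cweight q a b c d (z * (q : ℂ) ^ k)) atBot
        (nhds 0) := by
      have := hs.tendsto_cofinite_zero
      rw [Int.cofinite_eq] at this
      exact this.mono_left le_sup_left
    have t2 := (((tendsto_inv_qpow_atBot h0 h1 z).sub_const (b / q)).mul t1).const_mul a
    rw [mul_zero, mul_zero] at t2
    refine t2.congr fun k => ?_
    have := qpow_ne_zero h0 hz k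
    simp only [h]
    field_simp
  have key := tsum_int_telescope (h := h) (by simpa only [e] using sm) lim1 lim2
  simp only [e] at key
  rw [(hs'.mul_left _).tsum_sub (hs.mul_left _), tsum_mul_left, tsum_mul_left, sub_zero] at key
  exact key

lemma tendsto_bsum (h0 : 0 < q) (h1 : q < 1) (a b : ℂ) {c d z : ℂ} (hz : z ≠ 0)
    (hc0 : c ≠ 0) (hd0 : d ≠ 0)
    (hc : ∀ k : ℤ, c * (z * (q : ℂ) ^ k) ≠ 1) (hd : ∀ k : ℤ, d * (z * (q : ℂ) ^ k) ≠ 1) :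
    Tendsto (fun n : ℕ => bsum q (a * (q : ℂ) ^ n) b c d z) atTop (nhds (bsum q 0 b c d z)) := by
  have hq : (q : ℂ) ≠ 0 := by exact_mod_cast h0.ne'
  have hpos : 0 < ‖c * d * q‖ := by rw [norm_pos_iff]; simp [hq, hc0, hd0]
  have hl : Tendsto (fun n : ℕ => ‖a‖ * q ^ n * ‖b‖) atTop (nhds 0) := by
    simpa using ((tendsto_pow_atTop_nhds_zero_of_lt_one h0.le h1).const_mul ‖a‖).mul_const ‖b‖
  obtain ⟨N, hN⟩ := (hl.eventually_lt_const hpos).exists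
  let phase : ℝ → ℂ := fun t => -((t * ‖z‖ : ℝ) : ℂ) / z
  have hphase (t : ℝ) (ht : 0 ≤ t) : ‖phase t‖ = t := by
    simp only [phase, norm_div, norm_neg, Complex.norm_real]
    rw [Real.norm_of_nonneg (by positivity), mul_div_cancel_right₀ _ (norm_ne_zero_iff.2 hz)]
  have hphase_mul (t : ℝ) (k : ℤ) :
      phase t * (z * (q : ℂ) ^ k) = -((t * (‖z‖ * q ^ k) : ℝ) : ℂ) := by
    simp only [phase]
    push_cast
    field_simp
  have hx (k : ℤ) : ‖z * (q : ℂ) ^ k‖ = ‖z‖ * q ^ k := by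
    rw [norm_mul, norm_zpow, Complex.norm_real, Real.norm_of_nonneg h0.le]
  have hA : 0 ≤ ‖a‖ * q ^ N := by positivity
  have hsum := (summable_int_term_of_norm_lt h0 h1 (a := phase (‖a‖ * q ^ N)) (b := phase ‖b‖)
    hz hc0 hd0 hc hd (by rw [norm_mul, hphase _ hA, hphase _ (norm_nonneg b)]; exact hN)).norm
  refine tendsto_tsum_of_dominated_convergence hsum
    (fun k => (tendsto_cweight_num_zero h0 h1 a b c d _).const_mul _) ?_
  filter_upwards [eventually_ge_atTop N] with n hn k
  simp only [cweight, hphase_mul, norm_mul, norm_div]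
  have hqk : 0 < q ^ k := zpow_pos h0 k
  have hb1 : ‖poch q (b * (z * (q : ℂ) ^ k))‖ ≤
      ‖poch q (-((‖b‖ * (‖z‖ * q ^ k) : ℝ) : ℂ))‖ :=
    norm_poch_le h0 h1 (by rw [norm_mul, hx])
  have ha1 : ‖poch q (a * (q : ℂ) ^ n * (z * (q : ℂ) ^ k))‖ ≤
      ‖poch q (-((‖a‖ * q ^ N * (‖z‖ * q ^ k) : ℝ) : ℂ))‖ := by
    refine norm_poch_le h0 h1 ?_
    rw [norm_mul, hx, norm_mul, norm_pow, Complex.norm_real, Real.norm_of_nonneg h0.le]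
    have := pow_le_pow_of_le_one h0.le h1.le hn
    gcongr
  gcongr

lemma mul_eq_mul_of_recurrence {F u v : ℕ → ℂ} {U V L : ℂ}
    (hrec : ∀ n, F n * u n = v n * F (n + 1))
    (hu : Tendsto (fun n => ∏ i ∈ Finset.range n, u i) atTop (nhds U))
    (hv : Tendsto (fun n => ∏ i ∈ Finset.range n, v i) atTop (nhds V))
    (hF : Tendsto F atTop (nhds L)) : F 0 * U = V * L := by
  have key (n : ℕ) : F 0 * ∏ i ∈ Finset.range n, u i = (∏ i ∈ Finset.range n, v i) * F n := by
    induction n with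
    | zero => simp
    | succ n ih =>
      rw [Finset.prod_range_succ, Finset.prod_range_succ]
      linear_combination u n * ih + (∏ i ∈ Finset.range n, v i) * hrec n
  refine tendsto_nhds_unique (hu.const_mul (F 0)) ?_
  simp only [key]
  exact hv.mul hF

lemma bsum_sub_eq (h0 : 0 < q) (h1 : q < 1) {a b c d z y : ℂ} (hz : z ≠ 0) (hy : y ≠ 0)
    (hc0 : c ≠ 0) (hd0 : d ≠ 0)
    (hcz : ∀ k : ℤ, c * (z * (q : ℂ) ^ k) ≠ 1) (hdz : ∀ k : ℤ, d * (z * (q : ℂ) ^ k) ≠ 1)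
    (hcy : ∀ k : ℤ, c * (y * (q : ℂ) ^ k) ≠ 1) (hdy : ∀ k : ℤ, d * (y * (q : ℂ) ^ k) ≠ 1)
    (hsz : ∀ n : ℕ, Summable fun k : ℤ =>
      z * (q : ℂ) ^ k * cweight q (a * (q : ℂ) ^ n) b c d (z * (q : ℂ) ^ k))
    (hsy : ∀ n : ℕ, Summable fun k : ℤ =>
      y * (q : ℂ) ^ k * cweight q (a * (q : ℂ) ^ n) b c d (y * (q : ℂ) ^ k)) :
    (bsum q a b c d z - bsum q a b c d y) * poch q (a * b / (c * d * q)) =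
      poch q (a / c) * poch q (a / d) * (bsum q 0 b c d z - bsum q 0 b c d y) := by
  have hq : (q : ℂ) ≠ 0 := by exact_mod_cast h0.ne'
  have hpow (n : ℕ) : a * (q : ℂ) ^ (n + 1) = a * (q : ℂ) ^ n * q := by rw [pow_succ, mul_assoc]
  have hrec (n : ℕ) :
      (bsum q (a * (q : ℂ) ^ n) b c d z - bsum q (a * (q : ℂ) ^ n) b c d y) *
          (1 - a * b / (c * d * q) * (q : ℂ) ^ n) =
        (1 - a / c * (q : ℂ) ^ n) * (1 - a / d * (q : ℂ) ^ n) *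
          (bsum q (a * (q : ℂ) ^ (n + 1)) b c d z - bsum q (a * (q : ℂ) ^ (n + 1)) b c d y) := by
    have r1 := bsum_shift h0 h1 hz hcz hdz (hsz n) (by rw [← hpow]; exact hsz (n + 1))
    have r2 := bsum_shift h0 h1 hy hcy hdy (hsy n) (by rw [← hpow]; exact hsy (n + 1))
    rw [hpow]
    generalize bsum q (a * (q : ℂ) ^ n * q) b c d z = Z' at *
    generalize bsum q (a * (q : ℂ) ^ n * q) b c d y = Y' at *
    field_simp at r1 r2 ⊢
    linear_combination r2 - r1
  have key := mul_eq_mul_of_recurrence hrec (tendsto_pochN h0 h1 _)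
    (by simpa only [pochN, Finset.prod_mul_distrib] using
      (tendsto_pochN h0 h1 (a / c)).mul (tendsto_pochN h0 h1 (a / d)))
    ((tendsto_bsum h0 h1 a b hz hc0 hd0 hcz hdz).sub (tendsto_bsum h0 h1 a b hy hc0 hd0 hcy hdy))
  simpa using key

end BilateralSum

section UnilateralSum

variable {q : ℝ}

/-- The part over `z q^n`, `n ∈ ℕ`, of the Al-Salam–Verma type `q`-integral from `y` to `z`. -/
def usum (q : ℝ) (c d z y : ℂ) : ℂ :=
  ∑' n : ℕ, z * (q : ℂ) ^ n * cweight q (q / z) (q / y) c d (z * (q : ℂ) ^ n)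

lemma usum_swap_den (c d z y : ℂ) : usum q c d z y = usum q d c z y := by
  simp only [usum, cweight_swap_den _ _ c d]

lemma bsum_eq_usum (h0 : 0 < q) (h1 : q < 1) (c d : ℂ) {z y : ℂ} (hz : z ≠ 0) :
    bsum q (q / z) (q / y) c d z = usum q c d z y := by
  have hs := summable_int_term_of_terminating h0 h1 (q / y) c d hz 0
  have hv := cweight_qpow_eq_zero h0 (q / y) c d hz 0
  simp only [zero_add, pow_one, add_zero] at hs hv
  rw [bsum, tsum_int_eq_add hs]
  simp only [hv, mul_zero, tsum_zero, add_zero, zpow_natCast]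
  rfl

lemma usum_shift (h0 : 0 < q) (h1 : q < 1) {c d z y : ℂ} (hz : z ≠ 0) (hy : y ≠ 0)
    (hc : ∀ n : ℕ, c * (z * (q : ℂ) ^ n) ≠ 1) (hd : ∀ n : ℕ, d * (z * (q : ℂ) ^ n) ≠ 1) :
    (1 - c * d * z * y) * usum q (c * q) d z y - (1 - c * z) * (1 - c * y) * usum q c d z y =
      c * z * y := by
  have hq : (q : ℂ) ≠ 0 := by exact_mod_cast h0.ne'
  let h : ℕ → ℂ := fun n => c * z * y * ((1 - (z * (q : ℂ) ^ n) / z) * (1 - (z * (q : ℂ) ^ n) / y) *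
    cweight q (q / z) (q / y) c d (z * (q : ℂ) ^ n))
  have e (n : ℕ) : h (n + 1) - h n =
      (1 - c * d * z * y) * (z * (q : ℂ) ^ n *
          cweight q (q / z) (q / y) (c * q) d (z * (q : ℂ) ^ n)) -
        (1 - c * z) * (1 - c * y) * (z * (q : ℂ) ^ n *
          cweight q (q / z) (q / y) c d (z * (q : ℂ) ^ n)) := by
    simp only [h, pow_succ, ← mul_assoc z]
    have hcn := hc n
    have hdn := hd n
    generalize z * (q : ℂ) ^ n = x at *
    have s1 := cweight_den_shift h0 h1 (q / z) (q / y) d hcn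
    have s2 := cweight_mul_q h0 h1 (q / z) (q / y) hcn hdn
    rw [s1]
    generalize cweight q (q / z) (q / y) c d x = W at *
    generalize cweight q (q / z) (q / y) c d (x * q) = W' at *
    field_simp at s2 ⊢
    linear_combination c * s2
  have hs' := (summable_nat_term h0 h1 (q / z) (q / y) (c * q) d z).mul_left (1 - c * d * z * y)
  have hs := (summable_nat_term h0 h1 (q / z) (q / y) c d z).mul_left ((1 - c * z) * (1 - c * y))
  have hx := tendsto_qpow_nat h0 h1 z
  have lim : Tendsto h atTop (nhds (c * z * y)) := by
    have := ((((hx.div_const z).const_sub 1).mul ((hx.div_const y).const_sub 1)).mul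
      (tendsto_cweight_one h0 h1 (q / z) (q / y) c d hx)).const_mul (c * z * y)
    simpa [h] using this
  have key := tsum_nat_telescope (h := h) (by simpa only [e] using hs'.sub hs) lim
  simp only [e] at key
  rw [hs'.tsum_sub hs, tsum_mul_left, tsum_mul_left] at key
  have h00 : h 0 = 0 := by simp [h, hz]
  rw [h00, sub_zero] at key
  exact key

lemma tendsto_usum (h0 : 0 < q) (h1 : q < 1) (c d z y : ℂ) :
    Tendsto (fun n : ℕ => usum q (c * (q : ℂ) ^ n) d z y) atTop (nhds (usum q 0 d z y)) := by
  have split (c' x : ℂ) : cweight q (q / z) (q / y) c' d x =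
      cweight q (q / z) (q / y) 0 d x * (poch q (c' * x))⁻¹ := by
    simp only [cweight, zero_mul, poch_zero, div_eq_mul_inv, mul_inv]
    ring
  obtain ⟨C, hC⟩ := exists_norm_le_of_tendsto
    (tendsto_cweight_one h0 h1 (q / z) (q / y) 0 d (tendsto_qpow_nat h0 h1 z))
  obtain ⟨B, hB⟩ := exists_norm_le_of_tendsto
    ((tendsto_poch_one h0 h1 (tendsto_qpow_nat h0 h1 (c * z))).inv₀ one_ne_zero)
  have hC0 : 0 ≤ C := (norm_nonneg _).trans (hC 0)
  refine tendsto_tsum_of_dominated_convergence (bound := fun k => ‖z‖ * q ^ k * (C * B))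
    (((summable_geometric_of_lt_one h0.le h1).mul_left _).mul_right _) (fun k => ?_)
    (Eventually.of_forall fun n k => ?_)
  · simp only [split (c * (q : ℂ) ^ _)]
    have hp := (tendsto_poch_one h0 h1
      (by simpa using (tendsto_qpow_nat h0 h1 c).mul_const (z * (q : ℂ) ^ k) :
        Tendsto (fun n : ℕ => c * (q : ℂ) ^ n * (z * (q : ℂ) ^ k)) atTop (nhds 0))).inv₀ one_ne_zero
    simpa using (hp.const_mul (cweight q (q / z) (q / y) 0 d (z * (q : ℂ) ^ k))).const_mul
      (z * (q : ℂ) ^ k)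
  · rw [split, norm_mul, norm_mul, norm_mul, norm_pow, Complex.norm_real,
      Real.norm_of_nonneg h0.le]
    have b1 := hC k
    have b2 := hB (n + k)
    rw [show c * z * (q : ℂ) ^ (n + k) = c * (q : ℂ) ^ n * (z * (q : ℂ) ^ k) by ring] at b2
    gcongr

lemma usum_sub_eq (h0 : 0 < q) (h1 : q < 1) {c d z y : ℂ} (hz : z ≠ 0) (hy : y ≠ 0)
    (hcz : ∀ n : ℕ, c * (z * (q : ℂ) ^ n) ≠ 1) (hdz : ∀ n : ℕ, d * (z * (q : ℂ) ^ n) ≠ 1)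
    (hcy : ∀ n : ℕ, c * (y * (q : ℂ) ^ n) ≠ 1) (hdy : ∀ n : ℕ, d * (y * (q : ℂ) ^ n) ≠ 1) :
    (usum q c d z y - usum q c d y z) * (poch q (c * z) * poch q (c * y)) =
      poch q (c * d * z * y) * (usum q 0 d z y - usum q 0 d y z) := by
  have hrec (n : ℕ) :
      (usum q (c * (q : ℂ) ^ n) d z y - usum q (c * (q : ℂ) ^ n) d y z) *
          ((1 - c * z * (q : ℂ) ^ n) * (1 - c * y * (q : ℂ) ^ n)) =
        (1 - c * d * z * y * (q : ℂ) ^ n) *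
          (usum q (c * (q : ℂ) ^ (n + 1)) d z y - usum q (c * (q : ℂ) ^ (n + 1)) d y z) := by
    have hmul (x : ℂ) (m : ℕ) : c * (q : ℂ) ^ n * (x * (q : ℂ) ^ m) = c * (x * (q : ℂ) ^ (n + m)) := by
      ring
    have r1 := usum_shift h0 h1 (c := c * (q : ℂ) ^ n) hz hy
      (fun m => by rw [hmul]; exact hcz _) hdz
    have r2 := usum_shift h0 h1 (c := c * (q : ℂ) ^ n) hy hz
      (fun m => by rw [hmul]; exact hcy _) hdy
    rw [pow_succ, ← mul_assoc c]
    linear_combination r2 - r1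
  have key := mul_eq_mul_of_recurrence hrec
    (by simpa only [pochN, Finset.prod_mul_distrib] using
      (tendsto_pochN h0 h1 (c * z)).mul (tendsto_pochN h0 h1 (c * y)))
    (tendsto_pochN h0 h1 _) ((tendsto_usum h0 h1 c d z y).sub (tendsto_usum h0 h1 c d y z))
  simpa using key

lemma usum_sub_eq_zero_zero (h0 : 0 < q) (h1 : q < 1) {c d z y : ℂ} (hz : z ≠ 0) (hy : y ≠ 0)
    (hcz : ∀ n : ℕ, c * (z * (q : ℂ) ^ n) ≠ 1) (hdz : ∀ n : ℕ, d * (z * (q : ℂ) ^ n) ≠ 1)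
    (hcy : ∀ n : ℕ, c * (y * (q : ℂ) ^ n) ≠ 1) (hdy : ∀ n : ℕ, d * (y * (q : ℂ) ^ n) ≠ 1) :
    (usum q c d z y - usum q c d y z) *
        (poch q (c * z) * poch q (c * y) * (poch q (d * z) * poch q (d * y))) =
      poch q (c * d * z * y) * (usum q 0 0 z y - usum q 0 0 y z) := by
  have e1 := usum_sub_eq h0 h1 hz hy hcz hdz hcy hdy
  have e2 := usum_sub_eq h0 h1 (d := 0) hz hy hdz (by simp) hdy (by simp)
  simp only [mul_zero, zero_mul, poch_zero, one_mul] at e2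
  rw [usum_swap_den 0 d, usum_swap_den 0 d] at e1
  linear_combination (poch q (d * z) * poch q (d * y)) * e1 + poch q (c * d * z * y) * e2

lemma qpow_ne_one (h0 : 0 < q) (h1 : q < 1) (n : ℕ) : (q : ℂ) ^ (n + 1) ≠ 1 := by
  exact_mod_cast (pow_lt_one₀ h0.le h1 n.succ_ne_zero).ne

lemma usum_geometric (h0 : 0 < q) (h1 : q < 1) {z y : ℂ} (hz : z ≠ 0)
    (hzy : ∀ n : ℕ, z / y * (q : ℂ) ^ n ≠ 1) :
    usum q (q / z) (q / y) z y = z / (1 - q) := by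
  have hw (n : ℕ) : cweight q (q / z) (q / y) (q / z) (q / y) (z * (q : ℂ) ^ n) = 1 := by
    refine div_self (mul_ne_zero (poch_ne_zero h0 h1 fun j => ?_) (poch_ne_zero h0 h1 fun j => ?_))
    · rw [show (q : ℂ) / z * (z * (q : ℂ) ^ n) * (q : ℂ) ^ j = (q : ℂ) ^ (n + j + 1) by
        field_simp; ring]
      exact qpow_ne_one h0 h1 _
    · rw [show (q : ℂ) / y * (z * (q : ℂ) ^ n) * (q : ℂ) ^ j = z / y * (q : ℂ) ^ (n + j + 1) by
        ring]
      exact hzy _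
  simp only [usum, hw, mul_one]
  rw [tsum_mul_left, tsum_geometric_of_norm_lt_one (by simpa [abs_of_pos h0] using h1),
    div_eq_mul_inv]

lemma usum_zero_zero_sub (h0 : 0 < q) (h1 : q < 1) {z y : ℂ} (hz : z ≠ 0) (hy : y ≠ 0)
    (hzy : ∀ n : ℕ, z / y * (q : ℂ) ^ n ≠ 1) (hyz : ∀ n : ℕ, y / z * (q : ℂ) ^ n ≠ 1) :
    usum q 0 0 z y - usum q 0 0 y z = z * poch q q * theta q (y / z) := by
  have hself {x : ℂ} (hx : x ≠ 0) (n : ℕ) : (q : ℂ) / x * (x * (q : ℂ) ^ n) ≠ 1 := by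
    rw [show (q : ℂ) / x * (x * (q : ℂ) ^ n) = (q : ℂ) ^ (n + 1) by field_simp; ring]
    exact qpow_ne_one h0 h1 n
  have hother {x t : ℂ} (h : ∀ n : ℕ, t / x * (q : ℂ) ^ n ≠ 1) (n : ℕ) :
      (q : ℂ) / x * (t * (q : ℂ) ^ n) ≠ 1 := by
    rw [show (q : ℂ) / x * (t * (q : ℂ) ^ n) = t / x * (q : ℂ) ^ (n + 1) by ring]
    exact h _
  have key := usum_sub_eq_zero_zero h0 h1 hz hy (hself hz) (hother hzy) (hother hyz) (hself hy)
  rw [usum_geometric h0 h1 hz hzy, usum_swap_den _ _ y z, usum_geometric h0 h1 hy hyz,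
    div_mul_cancel₀ _ hz, div_mul_cancel₀ _ hy,
    show (q : ℂ) / z * (q / y) * z * y = q * q by field_simp] at key
  have hq1 : (1 - q : ℂ) ≠ 0 := sub_ne_zero.2 (by exact_mod_cast h1.ne')
  have hP : poch q ((q : ℂ) * q) ≠ 0 :=
    poch_ne_zero_of_norm_lt_one h0 h1 (by simpa [abs_of_pos h0] using by nlinarith)
  rw [theta, poch_eq_mul h0 h1 (y / z), show y / z * (q : ℂ) = q / z * y by ring,
    show (q : ℂ) / (y / z) = q / y * z by field_simp]
  rw [poch_eq_mul h0 h1 (q : ℂ)] at key ⊢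
  refine mul_left_cancel₀ hP (key.symm.trans ?_)
  field_simp

end UnilateralSum

section Evaluation

variable {q : ℝ}

lemma bsum_sub_eq_zero_zero (h0 : 0 < q) (h1 : q < 1) {a b c d z y : ℂ} (hz : z ≠ 0) (hy : y ≠ 0)
    (hc0 : c ≠ 0) (hd0 : d ≠ 0)
    (hcz : ∀ k : ℤ, c * (z * (q : ℂ) ^ k) ≠ 1) (hdz : ∀ k : ℤ, d * (z * (q : ℂ) ^ k) ≠ 1)
    (hcy : ∀ k : ℤ, c * (y * (q : ℂ) ^ k) ≠ 1) (hdy : ∀ k : ℤ, d * (y * (q : ℂ) ^ k) ≠ 1)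
    (hsz : ∀ n : ℕ, Summable fun k : ℤ =>
      z * (q : ℂ) ^ k * cweight q (a * (q : ℂ) ^ n) b c d (z * (q : ℂ) ^ k))
    (hsy : ∀ n : ℕ, Summable fun k : ℤ =>
      y * (q : ℂ) ^ k * cweight q (a * (q : ℂ) ^ n) b c d (y * (q : ℂ) ^ k)) :
    (bsum q a b c d z - bsum q a b c d y) * poch q (a * b / (c * d * q)) =
      poch q (a / c) * poch q (a / d) * poch q (b / c) * poch q (b / d) *
        (bsum q 0 0 c d z - bsum q 0 0 c d y) := by
  have hpos : 0 < ‖c * d * q‖ := by simp [h0.ne', hc0, hd0]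
  have e1 := bsum_sub_eq h0 h1 hz hy hc0 hd0 hcz hdz hcy hdy hsz hsy
  have e2 := bsum_sub_eq h0 h1 (a := b) (b := 0) hz hy hc0 hd0 hcz hdz hcy hdy
    (fun n => summable_int_term_of_norm_lt h0 h1 hz hc0 hd0 hcz hdz (by simpa using hpos))
    (fun n => summable_int_term_of_norm_lt h0 h1 hy hc0 hd0 hcy hdy (by simpa using hpos))
  rw [mul_zero, zero_div, poch_zero, mul_one] at e2
  rw [bsum_swap_num 0 b, bsum_swap_num 0 b, e2] at e1
  rw [e1]
  ring

lemma bsum_zero_zero_sub (h0 : 0 < q) (h1 : q < 1) {c d z y : ℂ} (hz : z ≠ 0) (hy : y ≠ 0)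
    (hc0 : c ≠ 0) (hd0 : d ≠ 0)
    (hcz : ∀ k : ℤ, c * (z * (q : ℂ) ^ k) ≠ 1) (hdz : ∀ k : ℤ, d * (z * (q : ℂ) ^ k) ≠ 1)
    (hcy : ∀ k : ℤ, c * (y * (q : ℂ) ^ k) ≠ 1) (hdy : ∀ k : ℤ, d * (y * (q : ℂ) ^ k) ≠ 1)
    (hzy : ∀ n : ℕ, z / y * (q : ℂ) ^ n ≠ 1) (hyz : ∀ n : ℕ, y / z * (q : ℂ) ^ n ≠ 1) :
    (bsum q 0 0 c d z - bsum q 0 0 c d y) *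
        (theta q (c * y) * theta q (d * y) * theta q (c * z) * theta q (d * z)) =
      z * poch q q * (theta q (y / z) * theta q (c * d * y * z)) := by
  have hq : (q : ℂ) ≠ 0 := by exact_mod_cast h0.ne'
  have hpow (x : ℂ) (n : ℕ) : (q : ℂ) / x * (q : ℂ) ^ n = (q : ℂ) ^ (n + 1) / x := by ring
  have e1 := bsum_sub_eq_zero_zero h0 h1 (a := q / z) (b := q / y) hz hy hc0 hd0 hcz hdz hcy hdy
    (fun n => by rw [hpow]; exact summable_int_term_of_terminating h0 h1 _ _ _ hz n)
    (fun n => by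
      simp only [cweight_swap_num _ ((q : ℂ) / y)]
      simpa using summable_int_term_of_terminating h0 h1 (q / z * (q : ℂ) ^ n) c d hy 0)
  rw [bsum_eq_usum h0 h1 c d hz, bsum_swap_num (q / z), bsum_eq_usum h0 h1 c d hy] at e1
  have e2 := usum_sub_eq_zero_zero h0 h1 hz hy (fun n => by simpa using hcz n)
    (fun n => by simpa using hdz n) (fun n => by simpa using hcy n) (fun n => by simpa using hdy n)
  rw [usum_zero_zero_sub h0 h1 hz hy hzy hyz] at e2
  rw [show (q : ℂ) / z * (q / y) / (c * d * q) = q / (c * d * y * z) by field_simp,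
    div_div, div_div, div_div, div_div] at e1
  rw [show c * d * z * y = c * d * y * z by ring] at e2
  simp only [theta] at e2 ⊢
  simp only [mul_comm c z, mul_comm c y, mul_comm d z, mul_comm d y] at *
  linear_combination
    poch q (q / (c * d * y * z)) * e2 -
      (poch q (z * c) * poch q (y * c) * (poch q (z * d) * poch q (y * d))) * e1

lemma theta_ne_zero (h0 : 0 < q) (h1 : q < 1) {x : ℂ} (hx0 : x ≠ 0)
    (hx : ∀ k : ℤ, x * (q : ℂ) ^ k ≠ 1) : theta q x ≠ 0 := by
  have hq : (q : ℂ) ≠ 0 := by exact_mod_cast h0.ne'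
  refine mul_ne_zero (poch_ne_zero h0 h1 fun j => by simpa using hx j)
    (poch_ne_zero h0 h1 fun j hj => hx (-((j : ℤ) + 1)) ?_)
  rw [zpow_neg, zpow_add_one₀ hq, zpow_natCast, ← div_eq_mul_inv, div_eq_one_iff_eq
    (mul_ne_zero (pow_ne_zero _ hq) hq)]
  field_simp at hj
  linear_combination -hj

/-- A pair satisfying `pairCond` has nonnegative product. -/
lemma mul_eq_norm_of_pairCond {zm zp : ℝ} {α β : ℂ} (h0 : 0 < q) (hzm : zm < 0) (hzp : 0 < zp)
    (h : pairCond q zm zp α β) : α * β = (‖α * β‖ : ℂ) := by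
  have real {A B : ℝ} (h : 0 ≤ A * B) : (A : ℂ) * B = (‖(A : ℂ) * B‖ : ℂ) := by
    rw [← Complex.ofReal_mul, Complex.norm_real, Real.norm_of_nonneg h]
  rcases h with rfl | ⟨A, B, k, rfl, rfl, hB, hBA, -⟩ | ⟨A, B, k, rfl, rfl, -, hAB, hB⟩
  · rw [norm_mul, RCLike.norm_conj, mul_comm, Complex.mul_conj, Complex.normSq_eq_norm_sq]
    push_cast
    ring
  · have h3 : 0 < 1 / B := (mul_pos hzp (zpow_pos h0 k)).trans hB
    have h4 : 0 < 1 / A := h3.trans hBA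
    exact real (mul_pos (one_div_pos.1 h4) (one_div_pos.1 h3)).le
  · have h3 : 1 / B < 0 := hB.trans (mul_neg_of_neg_of_pos hzm (zpow_pos h0 k))
    have h4 : 1 / A < 0 := hAB.trans h3
    exact real (mul_pos_of_neg_of_neg (one_div_neg.1 h4) (one_div_neg.1 h3)).le

end Evaluation

/-- the q-integral of the weight function (a ₂ψ₂ summation formula). -/
theorem statement17 (q zm zp : ℝ) (a b c d : ℂ)
    (hq0 : 0 < q) (hq1 : q < 1) (hzm : zm < 0) (hzp : 0 < zp)
    (hP : memP q zm zp a b c d) (hab : (a * b).re < (c * d * (q : ℂ)).re) :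
    Summable (fun k : ℤ => ‖((zp * q ^ k : ℝ) : ℂ) * w q a b c d (zp * q ^ k)‖) ∧
    Summable (fun k : ℤ => ‖((zm * q ^ k : ℝ) : ℂ) * w q a b c d (zm * q ^ k)‖) ∧
    (∑' k : ℤ, ((zp * q ^ k : ℝ) : ℂ) * w q a b c d (zp * q ^ k)) -
        (∑' k : ℤ, ((zm * q ^ k : ℝ) : ℂ) * w q a b c d (zm * q ^ k)) =
      (zp : ℂ) *
        (poch q q * poch q (a / c) * poch q (a / d) * poch q (b / c) * poch q (b / d)) *
        (theta q ((zm : ℂ) / zp) * theta q (c * d * zm * zp)) /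
        (poch q (a * b / (c * d * q)) *
          (theta q (c * zm) * theta q (d * zm) * theta q (c * zp) * theta q (d * zp))) := by

  obtain ⟨-, -, hc0, hd0, -, hpole, hpab, hpcd⟩ := hP
  have hq : (q : ℂ) ≠ 0 := by exact_mod_cast hq0.ne'
  have hz : (zp : ℂ) ≠ 0 := by exact_mod_cast hzp.ne'
  have hy : (zm : ℂ) ≠ 0 := by exact_mod_cast hzm.ne
  have hlt : ‖a * b‖ < ‖c * d * q‖ := by
    have e1 := mul_eq_norm_of_pairCond hq0 hzm hzp hpab
    have e2 := mul_eq_norm_of_pairCond hq0 hzm hzp hpcd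
    rw [e1, e2, ← Complex.ofReal_mul, Complex.ofReal_re, Complex.ofReal_re] at hab
    rwa [norm_mul (c * d), Complex.norm_real, Real.norm_of_nonneg hq0.le]
  have nopole {x z : ℂ} (hz : z ≠ 0) (h : ∀ k : ℤ, x ≠ z⁻¹ * (q : ℂ) ^ k) (k : ℤ) :
      x * (z * (q : ℂ) ^ k) ≠ 1 := fun h1 => by
    refine h (-k) ?_
    rw [zpow_neg, ← mul_inv]
    exact eq_inv_of_mul_eq_one_left h1
  have hcz := nopole hz fun k => (hpole c (by simp) k).1
  have hcy := nopole hy fun k => (hpole c (by simp) k).2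
  have hdz := nopole hz fun k => (hpole d (by simp) k).1
  have hdy := nopole hy fun k => (hpole d (by simp) k).2
  have hneg {s t : ℝ} (hst : s / t < 0) (n : ℕ) : (s : ℂ) / t * (q : ℂ) ^ n ≠ 1 := by
    have h1 : s / t * q ^ n ≠ 1 :=
      ((mul_neg_of_neg_of_pos hst (pow_pos hq0 n)).trans one_pos).ne
    exact_mod_cast h1
  have hzy := hneg (div_neg_of_pos_of_neg hzp hzm)
  have hyz := hneg (div_neg_of_neg_of_pos hzm hzp)
  have hlt_shift (n : ℕ) : ‖a * (q : ℂ) ^ n * b‖ < ‖c * d * q‖ := by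
    refine lt_of_le_of_lt ?_ hlt
    rw [mul_right_comm, norm_mul, norm_pow, Complex.norm_real, Real.norm_of_nonneg hq0.le]
    exact mul_le_of_le_one_right (norm_nonneg _) (pow_le_one₀ hq0.le hq1.le)
  have hterm (z : ℝ) (k : ℤ) : ((z * q ^ k : ℝ) : ℂ) * w q a b c d (z * q ^ k) =
      (z : ℂ) * (q : ℂ) ^ k * cweight q a b c d (z * (q : ℂ) ^ k) := by
    simp only [w, cweight]
    push_cast
    rfl
  simp only [hterm]
  refine ⟨(summable_int_term_of_norm_lt hq0 hq1 hz hc0 hd0 hcz hdz hlt).norm,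
    (summable_int_term_of_norm_lt hq0 hq1 hy hc0 hd0 hcy hdy hlt).norm, ?_⟩
  have e1 := bsum_sub_eq_zero_zero hq0 hq1 hz hy hc0 hd0 hcz hdz hcy hdy
    (fun n => summable_int_term_of_norm_lt hq0 hq1 hz hc0 hd0 hcz hdz (hlt_shift n))
    (fun n => summable_int_term_of_norm_lt hq0 hq1 hy hc0 hd0 hcy hdy (hlt_shift n))
  have e2 := bsum_zero_zero_sub hq0 hq1 hz hy hc0 hd0 hcz hdz hcy hdy hzy hyz
  have hP : poch q (a * b / (c * d * q)) ≠ 0 := by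
    refine poch_ne_zero_of_norm_lt_one hq0 hq1 ?_
    rw [norm_div, div_lt_one ((norm_nonneg _).trans_lt hlt)]
    exact hlt
  have hθ {x z : ℂ} (hx : x ≠ 0) (hz : z ≠ 0) (h : ∀ k : ℤ, x * (z * (q : ℂ) ^ k) ≠ 1) :
      theta q (x * z) ≠ 0 :=
    theta_ne_zero hq0 hq1 (mul_ne_zero hx hz) fun k => by rw [mul_assoc]; exact h k
  rw [eq_div_iff (mul_ne_zero hP (mul_ne_zero (mul_ne_zero (mul_ne_zero (hθ hc0 hy hcy)
    (hθ hd0 hy hdy)) (hθ hc0 hz hcz)) (hθ hd0 hz hdz)))]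
  change (bsum q a b c d zp - bsum q a b c d zm) * _ = _
  linear_combination
    (theta q (c * zm) * theta q (d * zm) * theta q (c * zp) * theta q (d * zp)) * e1 +
      poch q (a / c) * poch q (a / d) * poch q (b / c) * poch q (b / d) * e2
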